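/- arXiv:1410.5024 — 4 statements merged into one kernel-verified Lean document; each statement's English description precedes it below -/
import Mathlib

section
/- Let α > 0, let s ∈ ℝ^L with L = N·P be partitioned into N consecutive groups s_[1], …, s_[N] of size P, and define for each index k: g_k(s) = 2α²·s_k − 2α·s_k/‖s_[⌈k/P⌉]‖_2 if 0 < ‖s_[⌈k/P⌉]‖_2 ≤ 1/α, and g_k(s) = 0 otherwise. Let G(s) = ∑_{k=1}^{L} g_k(s)² and let Q = P·(number of groups i with ‖s_[i]‖_2 ≠ 0). If s ≠ 0, then G(s) < 4α²·Q/P. -/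
/-- The index in `Fin (N * P)` of the `j`-th entry of the `i`-th group. -/
def groupIdx (N P : ℕ) (i : Fin N) (j : Fin P) : Fin (N * P) :=
  ⟨i.val * P + j.val, by
    have hi := i.isLt
    have hj := j.isLt
    calc i.val * P + j.val < i.val * P + P := by omega
      _ = (i.val + 1) * P := by ring
      _ ≤ N * P := Nat.mul_le_mul_right P hi⟩

theorem groupIdx_eq_finProdFinEquiv (N P : ℕ) (i : Fin N) (j : Fin P) :
    groupIdx N P i j = finProdFinEquiv (i, j) := by
  apply Fin.ext
  simp only [groupIdx, finProdFinEquiv_apply_val]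
  ring

theorem sum_eq_sum_groupIdx {M : Type*} [AddCommMonoid M] (N P : ℕ) (f : Fin (N * P) → M) :
    ∑ k, f k = ∑ i, ∑ j, f (groupIdx N P i j) := by
  simp only [groupIdx_eq_finProdFinEquiv]
  rw [← Equiv.sum_comp finProdFinEquiv f, Fintype.sum_prod_type]

/-- The energy of the zero-point attraction on a group of norm `r` in `(0, 1/α]`. -/
theorem sum_sq_attraction_lt {ι : Type*} [Fintype ι] {α r : ℝ} (hα : 0 < α) (hr : 0 < r)
    (hrα : r ≤ 1 / α) (v : ι → ℝ) (hv : ∑ j, v j ^ 2 = r ^ 2) :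
    ∑ j, (2 * α ^ 2 * v j - 2 * α * v j / r) ^ 2 < 4 * α ^ 2 := by
  have hsum : ∑ j, (2 * α ^ 2 * v j - 2 * α * v j / r) ^ 2 = 4 * α ^ 2 * (1 - α * r) ^ 2 := by
    calc ∑ j, (2 * α ^ 2 * v j - 2 * α * v j / r) ^ 2
        = ∑ j, (2 * α ^ 2 - 2 * α / r) ^ 2 * v j ^ 2 :=
          Finset.sum_congr rfl fun j _ => by ring
      _ = (2 * α ^ 2 - 2 * α / r) ^ 2 * r ^ 2 := by rw [← Finset.mul_sum, hv]
      _ = 4 * α ^ 2 * (1 - α * r) ^ 2 := by field_simp; ring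
  have hle : α * r ≤ 1 := by
    rw [le_div_iff₀ hα] at hrα
    linarith
  have hpos : 0 < α * r := mul_pos hα hr
  rw [hsum]
  exact mul_lt_of_lt_one_right (by positivity) (by nlinarith)

/-- Let `s ∈ ℝ^(N·P)` be partitioned into `N` groups of size `P`, let
`gn i = ‖s_[i]‖₂` be the group norms, and let the group zero-point attraction be
`g_k(s) = 2α² s_k - 2α s_k / ‖s_[⌈k/P⌉]‖₂` when `0 < ‖s_[⌈k/P⌉]‖₂ ≤ 1/α` and `0`
otherwise.  With `G(s) = ∑_k g_k(s)²` and `Q = P · #{i : ‖s_[i]‖₂ ≠ 0}`, if `s ≠ 0` then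
`G(s) < 4α² Q / P`. -/
theorem stmt_7 (N P : ℕ) (hP : 0 < P) (α : ℝ) (hα : 0 < α) (s : Fin (N * P) → ℝ)
    (gn : Fin N → ℝ)
    (hgn : ∀ i : Fin N, gn i = Real.sqrt (∑ j : Fin P, (s (groupIdx N P i j)) ^ 2))
    (g : Fin (N * P) → ℝ)
    (hg : ∀ (i : Fin N) (j : Fin P),
      g (groupIdx N P i j) =
        if 0 < gn i ∧ gn i ≤ 1 / α then
          2 * α ^ 2 * s (groupIdx N P i j) - 2 * α * s (groupIdx N P i j) / gn i
        else 0)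
    (Q : ℕ) (hQ : Q = P * (Finset.univ.filter (fun i : Fin N => gn i ≠ 0)).card)
    (hs : s ≠ 0) :
    ∑ k : Fin (N * P), (g k) ^ 2 < 4 * α ^ 2 * Q / P := by
  have hsq (i : Fin N) : ∑ j, s (groupIdx N P i j) ^ 2 = gn i ^ 2 := by
    rw [hgn i, Real.sq_sqrt (Finset.sum_nonneg fun j _ => sq_nonneg _)]
  have hlt (i : Fin N) : ∑ j, g (groupIdx N P i j) ^ 2 < 4 * α ^ 2 := by
    simp only [hg]
    split_ifs with h
    · exact sum_sq_attraction_lt hα h.1 h.2 _ (hsq i)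
    · simpa using pow_pos hα 2
  have hzero (i : Fin N) (hi : gn i = 0) : ∑ j, g (groupIdx N P i j) ^ 2 = 0 := by
    simp [hg, hi]
  obtain ⟨i₀, hi₀⟩ : ∃ i, gn i ≠ 0 := by
    by_contra! h
    have hs_sum : ∑ k, s k ^ 2 = 0 := by simp [sum_eq_sum_groupIdx, hsq, h]
    refine hs (funext fun k => ?_)
    have hk := (Finset.sum_eq_zero_iff_of_nonneg fun k _ => sq_nonneg (s k)).1 hs_sum k
      (Finset.mem_univ k)
    simpa using hk
  have hP' : (P : ℝ) ≠ 0 := by exact_mod_cast hP.ne'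
  have hbound : 4 * α ^ 2 * Q / P = ∑ i with gn i ≠ 0, 4 * α ^ 2 := by
    rw [Finset.sum_const, nsmul_eq_mul, hQ, Nat.cast_mul, div_eq_iff hP']
    ring
  have hsupp : ∑ k, g k ^ 2 = ∑ i with gn i ≠ 0, ∑ j, g (groupIdx N P i j) ^ 2 := by
    rw [sum_eq_sum_groupIdx, Finset.sum_filter_of_ne]
    exact fun i _ h hi => h (hzero i hi)
  rw [hbound, hsupp]
  exact Finset.sum_lt_sum_of_nonempty ⟨i₀, by simpa using hi₀⟩ fun i _ => hlt i
end

section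
/- Let β1, β2, β3 and C be real numbers with β1 > β2 > 0 and β3 > 0, and define D(κ) = C + β1·κ² − β2·κ·√(κ² + β3) for κ ≥ 0. Then D attains its minimum over κ ≥ 0 at κ_opt = (√β3 / 2)·( ((β1 + β2)/(β1 − β2))^(1/4) − ((β1 − β2)/(β1 + β2))^(1/4) ), and the minimum value is D(κ_opt) = C + (β3/2)·( √(β1² − β2²) − β1 ); moreover D(κ) ≥ D(κ_opt) for all κ ≥ 0. -/
/-- If `w² = a² - b²` and `a + w > 0`, the quadratic form `a (x² + y²) - 2 b x y` dominates
`w (y² - x²)`. -/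
theorem mul_sq_sub_sq_le_of_sq_eq {a b w : ℝ} (haw : 0 < a + w) (hw : w ^ 2 = a ^ 2 - b ^ 2)
    (x y : ℝ) : w * (y ^ 2 - x ^ 2) ≤ a * (x ^ 2 + y ^ 2) - 2 * b * x * y := by
  have key : (a + w) * (a * (x ^ 2 + y ^ 2) - 2 * b * x * y - w * (y ^ 2 - x ^ 2)) =
      ((a + w) * x - b * y) ^ 2 := by
    linear_combination -y ^ 2 * hw
  have := nonneg_of_mul_nonneg_right (key ▸ sq_nonneg _) haw
  linarith

/-- For reals `β1 > β2 > 0`, `β3 > 0` and `C`, the function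
`D(κ) = C + β1 κ² - β2 κ √(κ² + β3)` attains its minimum over `κ ≥ 0` at
`κ_opt = (√β3/2) (((β1+β2)/(β1-β2))^(1/4) - ((β1-β2)/(β1+β2))^(1/4))`, with minimum value
`D(κ_opt) = C + (β3/2) (√(β1² - β2²) - β1)`, and `D(κ) ≥ D(κ_opt)` for all `κ ≥ 0`. -/
theorem stmt_8 (β1 β2 β3 C : ℝ) (h21 : β2 < β1) (h2 : 0 < β2) (h3 : 0 < β3)
    (D : ℝ → ℝ)
    (hD : ∀ κ, D κ = C + β1 * κ ^ 2 - β2 * κ * Real.sqrt (κ ^ 2 + β3))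
    (κopt : ℝ)
    (hκ : κopt = Real.sqrt β3 / 2 *
      (((β1 + β2) / (β1 - β2)) ^ ((1 : ℝ) / 4) - ((β1 - β2) / (β1 + β2)) ^ ((1 : ℝ) / 4))) :
    0 ≤ κopt ∧
    D κopt = C + β3 / 2 * (Real.sqrt (β1 ^ 2 - β2 ^ 2) - β1) ∧
    ∀ κ, 0 ≤ κ → D κopt ≤ D κ := by
  have hd : 0 < β1 - β2 := sub_pos.2 h21
  have hs : 0 < β1 + β2 := by linarith
  have hw0 := Real.sqrt_nonneg (β1 ^ 2 - β2 ^ 2)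
  have hw : Real.sqrt (β1 ^ 2 - β2 ^ 2) ^ 2 = β1 ^ 2 - β2 ^ 2 := Real.sq_sqrt (by nlinarith)
  have hquot : 1 ≤ (β1 + β2) / (β1 - β2) := (one_le_div hd).2 (by linarith)
  rw [← inv_div (β1 + β2), Real.inv_rpow (by positivity)] at hκ
  have ht4 : (((β1 + β2) / (β1 - β2)) ^ ((1 : ℝ) / 4)) ^ 4 = (β1 + β2) / (β1 - β2) := by
    rw [← Real.rpow_mul_natCast (by positivity)]
    norm_num
  have ht1 : 1 ≤ ((β1 + β2) / (β1 - β2)) ^ ((1 : ℝ) / 4) :=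
    Real.one_le_rpow hquot (by norm_num)
  generalize ((β1 + β2) / (β1 - β2)) ^ ((1 : ℝ) / 4) = t at hκ ht4 ht1
  have ht : 0 < t := by linarith
  rw [eq_div_iff hd.ne'] at ht4
  have hsq : Real.sqrt β3 ^ 2 = β3 := Real.sq_sqrt h3.le
  have hroot : Real.sqrt (κopt ^ 2 + β3) = Real.sqrt β3 / 2 * (t + t⁻¹) := by
    rw [Real.sqrt_eq_iff_mul_self_eq_of_pos (by positivity), hκ]
    field_simp
    linear_combination 4 * t ^ 2 * hsq
  have hwt : Real.sqrt (β1 ^ 2 - β2 ^ 2) = (β1 - β2) * t ^ 2 := by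
    rw [Real.sqrt_eq_iff_mul_self_eq_of_pos (by positivity)]
    linear_combination (β1 - β2) * ht4
  have hmin : D κopt = C + β3 / 2 * (Real.sqrt (β1 ^ 2 - β2 ^ 2) - β1) := by
    rw [hD, hroot, hwt, hκ]
    field_simp
    rw [hsq]
    linear_combination (-β3) * ht4
  refine ⟨?_, hmin, fun κ _ => ?_⟩
  · rw [hκ]
    have := inv_le_one_of_one_le₀ ht1
    exact mul_nonneg (by positivity) (by linarith)
  · have hy : Real.sqrt (κ ^ 2 + β3) ^ 2 = κ ^ 2 + β3 := Real.sq_sqrt (by positivity)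
    have := mul_sq_sub_sq_le_of_sq_eq (by linarith) hw κ (Real.sqrt (κ ^ 2 + β3))
    rw [hy] at this
    rw [hmin, hD]
    linarith
end

section
/- Let m ≥ 1 be an integer and α > 0. Let γ_m denote the standard Gaussian measure on ℝ^m (i.i.d. N(0,1) coordinates). Then ∫_{ℝ^m} 1{‖x‖_2 ≤ 1/α}·( 4α⁴‖x‖_2² − 8α³‖x‖_2 + 4α² ) dγ_m(x) = (4α²/Γ(m/2))·[ 2α²·γ((m+2)/2, 1/(2α²)) + γ(m/2, 1/(2α²)) − 2√2·α·γ((m+1)/2, 1/(2α²)) ], where Γ is the gamma function and γ(a, x) = ∫_0^x t^(a−1) e^(−t) dt is the lower incomplete gamma function. -/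
open MeasureTheory ProbabilityTheory

/-- The lower incomplete gamma function `γ(a, x) = ∫_0^x t^(a-1) e^(-t) dt`. -/
noncomputable def lowerIncompleteGamma (a x : ℝ) : ℝ :=
  ∫ t in (0 : ℝ)..x, t ^ (a - 1) * Real.exp (-t)

/-- A finite product of nondegenerate real Gaussian measures has the product density. -/
lemma pi_gaussianReal_eq_withDensity {ι : Type*} [Fintype ι] (μ : ℝ) {v : NNReal} (hv : v ≠ 0) :
    (Measure.pi fun _ : ι => gaussianReal μ v) =
      volume.withDensity fun x : ι → ℝ => ENNReal.ofReal (∏ i, gaussianPDFReal μ v (x i)) := by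
  refine Measure.pi_eq fun s hs => ?_
  have h_integrable : ∀ i, Integrable (gaussianPDFReal μ v) (volume.restrict (s i)) := fun i =>
    (integrable_gaussianPDFReal μ v).integrableOn
  rw [withDensity_apply _ (MeasurableSet.univ_pi hs), volume_pi, Measure.restrict_pi_pi,
    ← ofReal_integral_eq_lintegral_ofReal (Integrable.fintype_prod h_integrable)
      (ae_of_all _ fun x => Finset.prod_nonneg fun i _ => gaussianPDFReal_nonneg μ v (x i)),
    integral_fintype_prod_eq_prod (fun _ => gaussianPDFReal μ v),
    ENNReal.ofReal_prod_of_nonneg fun i _ =>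
      integral_nonneg fun x => gaussianPDFReal_nonneg μ v x]
  exact Finset.prod_congr rfl fun i _ => (gaussianReal_apply_eq_integral μ hv (s i)).symm

/-- The joint density of independent standard Gaussian variables. -/
lemma prod_gaussianPDFReal_zero_one {ι : Type*} [Fintype ι] (x : ι → ℝ) :
    ∏ i, gaussianPDFReal 0 1 (x i) =
      (Real.sqrt (2 * Real.pi) ^ Fintype.card ι)⁻¹ * Real.exp (-(∑ i, x i ^ 2) / 2) := by
  simp only [gaussianPDFReal, Finset.prod_mul_distrib, Finset.prod_const, Finset.card_univ,
    NNReal.coe_one, mul_one, sub_zero, ← Real.exp_sum, ← Finset.sum_div, Finset.sum_neg_distrib,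
    inv_pow]

/-- The substitution `t = r ^ 2 / 2` in a radial Gaussian integral. -/
lemma integral_Ioi_pow_mul_exp_neg_sq_half {m : ℕ} (hm : 1 ≤ m) (f : ℝ → ℝ) :
    ∫ r in Set.Ioi (0 : ℝ), r ^ (m - 1) * (Real.exp (-r ^ 2 / 2) * f r) =
      2 ^ ((m : ℝ) / 2 - 1) * ∫ t in Set.Ioi (0 : ℝ),
        t ^ ((m : ℝ) / 2 - 1) * Real.exp (-t) * f (Real.sqrt (2 * t)) := by
  have hscale := integral_comp_mul_left_Ioi (fun t : ℝ =>
    t ^ ((m : ℝ) / 2 - 1) * Real.exp (-t) * f (Real.sqrt (2 * t))) 0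
    (b := (1 / 2 : ℝ)) (by norm_num)
  have hsq := integral_comp_rpow_Ioi_of_pos (g := fun t : ℝ =>
    (1 / 2 * t) ^ ((m : ℝ) / 2 - 1) * Real.exp (-(1 / 2 * t)) * f (Real.sqrt (2 * (1 / 2 * t))))
    (p := 2) (by norm_num)
  rw [mul_zero, ← hsq, smul_eq_mul] at hscale
  have h2 : (0 : ℝ) < 2 ^ ((m : ℝ) / 2 - 1) := by positivity
  have hcongr : ∫ r in Set.Ioi (0 : ℝ), r ^ (m - 1) * (Real.exp (-r ^ 2 / 2) * f r) =
      2 ^ ((m : ℝ) / 2 - 1) / 2 * ∫ x in Set.Ioi (0 : ℝ), (2 * x ^ ((2 : ℝ) - 1)) •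
        ((1 / 2 * x ^ (2 : ℝ)) ^ ((m : ℝ) / 2 - 1) * Real.exp (-(1 / 2 * x ^ (2 : ℝ))) *
          f (Real.sqrt (2 * (1 / 2 * x ^ (2 : ℝ))))) := by
    rw [← integral_const_mul]
    refine setIntegral_congr_fun measurableSet_Ioi fun r hr => ?_
    have hr : 0 < r := hr
    have hroot : Real.sqrt (2 * (1 / 2 * r ^ (2 : ℝ))) = r := by
      rw [← mul_assoc, mul_one_div_cancel two_ne_zero, one_mul, Real.rpow_two,
        Real.sqrt_sq hr.le]
    have hpow : r ^ (m - 1) =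
        r * (2 ^ ((m : ℝ) / 2 - 1) * (1 / 2 * r ^ (2 : ℝ)) ^ ((m : ℝ) / 2 - 1)) := by
      rw [← Real.mul_rpow (by positivity) (by positivity), ← mul_assoc,
        mul_one_div_cancel two_ne_zero, one_mul, ← Real.rpow_mul hr.le, ← Real.rpow_natCast,
        Nat.cast_sub hm, mul_comm r, ← Real.rpow_add_one hr.ne']
      congr 1
      push_cast
      ring
    have hexp : -(1 / 2 * r ^ (2 : ℝ)) = -r ^ 2 / 2 := by rw [Real.rpow_two]; ring
    have hone : r ^ ((2 : ℝ) - 1) = r := by norm_num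
    simp only [hroot, hexp, hone, smul_eq_mul]
    rw [hpow]
    ring
  rw [hcongr, hscale]
  ring

/-- The squared norm of a standard Gaussian vector, halved, has the `Γ(m / 2)` distribution. -/
lemma integral_comp_sqrt_sum_sq_pi_gaussianReal {m : ℕ} (hm : 1 ≤ m) (f : ℝ → ℝ) :
    ∫ x : Fin m → ℝ, f (Real.sqrt (∑ i, x i ^ 2)) ∂(Measure.pi fun _ => gaussianReal 0 1) =
      (Real.Gamma ((m : ℝ) / 2))⁻¹ * ∫ t in Set.Ioi (0 : ℝ),
        t ^ ((m : ℝ) / 2 - 1) * Real.exp (-t) * f (Real.sqrt (2 * t)) := by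
  have : Nonempty (Fin m) := ⟨⟨0, hm⟩⟩
  have hm0 : (0 : ℝ) < m := by exact_mod_cast hm
  have hmeas : Measurable fun x : Fin m → ℝ =>
      ENNReal.ofReal (∏ i, gaussianPDFReal 0 1 (x i)) := by fun_prop
  have hG : 0 < Real.Gamma ((m : ℝ) / 2) := Real.Gamma_pos_of_pos (by positivity)
  calc
    _ = ∫ x : Fin m → ℝ, (Real.sqrt (2 * Real.pi) ^ m)⁻¹ *
        (Real.exp (-Real.sqrt (∑ i, x i ^ 2) ^ 2 / 2) * f (Real.sqrt (∑ i, x i ^ 2))) := by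
      rw [pi_gaussianReal_eq_withDensity 0 one_ne_zero,
        integral_withDensity_eq_integral_toReal_smul hmeas
          (ae_of_all _ fun _ => ENNReal.ofReal_lt_top)]
      refine integral_congr_ae (ae_of_all _ fun x => ?_)
      simp only [smul_eq_mul]
      rw [ENNReal.toReal_ofReal (Finset.prod_nonneg fun i _ => gaussianPDFReal_nonneg 0 1 (x i)),
        prod_gaussianPDFReal_zero_one, Fintype.card_fin,
        Real.sq_sqrt (Finset.sum_nonneg fun i _ => sq_nonneg (x i)), mul_assoc]
    _ = ∫ y : EuclideanSpace ℝ (Fin m), (Real.sqrt (2 * Real.pi) ^ m)⁻¹ *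
        (Real.exp (-‖y‖ ^ 2 / 2) * f ‖y‖) := by
      rw [← (PiLp.volume_preserving_toLp (Fin m)).integral_comp
        (MeasurableEquiv.toLp 2 (Fin m → ℝ)).measurableEmbedding]
      simp [EuclideanSpace.norm_eq]
    _ = (Real.sqrt (2 * Real.pi) ^ m)⁻¹ * (m * (Real.sqrt Real.pi ^ m /
        Real.Gamma ((m : ℝ) / 2 + 1) * (2 ^ ((m : ℝ) / 2 - 1) * ∫ t in Set.Ioi (0 : ℝ),
          t ^ ((m : ℝ) / 2 - 1) * Real.exp (-t) * f (Real.sqrt (2 * t))))) := by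
      have hG1 : 0 < Real.Gamma ((m : ℝ) / 2 + 1) := Real.Gamma_pos_of_pos (by positivity)
      rw [integral_const_mul,
        integral_fun_norm_addHaar volume fun r => Real.exp (-r ^ 2 / 2) * f r,
        finrank_euclideanSpace, Fintype.card_fin, Measure.real, EuclideanSpace.volume_ball]
      simp only [smul_eq_mul, nsmul_eq_mul]
      rw [integral_Ioi_pow_mul_exp_neg_sq_half hm, Fintype.card_fin, ENNReal.ofReal_one, one_pow,
        one_mul, ENNReal.toReal_ofReal (by positivity)]
    _ = _ := by
      have hsqrt : Real.sqrt 2 ^ m = 2 ^ ((m : ℝ) / 2 - 1) * 2 := by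
        rw [Real.sqrt_eq_rpow, ← Real.rpow_mul_natCast two_pos.le,
          ← Real.rpow_add_one two_ne_zero]
        congr 1
        ring
      have h2 : (0 : ℝ) < 2 ^ ((m : ℝ) / 2 - 1) := by positivity
      have hpi : 0 < Real.sqrt Real.pi ^ m := by positivity
      rw [Real.Gamma_add_one (by positivity), Real.sqrt_mul two_pos.le, mul_pow, hsqrt]
      field_simp

/-- The integrand of the lower incomplete gamma function is integrable near zero. -/
lemma integrableOn_Ioc_rpow_mul_exp_neg {a : ℝ} (ha : 0 < a) (x : ℝ) :
    IntegrableOn (fun t : ℝ => t ^ (a - 1) * Real.exp (-t)) (Set.Ioc 0 x) := by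
  have h := (Real.GammaIntegral_convergent ha).mono_set
    (Set.Ioc_subset_Ioi_self : Set.Ioc 0 x ⊆ Set.Ioi 0)
  simpa only [mul_comm] using h

/-- Let `γ_m` be the standard Gaussian measure on `ℝ^m` (i.i.d. `N(0,1)`
coordinates).  For `α > 0`,
`∫ 1{‖x‖₂ ≤ 1/α} (4α⁴‖x‖₂² - 8α³‖x‖₂ + 4α²) dγ_m(x)
  = (4α²/Γ(m/2)) [2α² γ((m+2)/2, 1/(2α²)) + γ(m/2, 1/(2α²)) - 2√2 α γ((m+1)/2, 1/(2α²))]`,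
where `Γ` is the gamma function and `γ(a,x)` the lower incomplete gamma function. -/
theorem stmt_10 (m : ℕ) (hm : 1 ≤ m) (α : ℝ) (hα : 0 < α) :
    ∫ x : Fin m → ℝ,
        (if Real.sqrt (∑ i, x i ^ 2) ≤ 1 / α then
          4 * α ^ 4 * (∑ i, x i ^ 2) - 8 * α ^ 3 * Real.sqrt (∑ i, x i ^ 2) + 4 * α ^ 2
        else 0)
        ∂(Measure.pi fun _ : Fin m => gaussianReal 0 1)
      = 4 * α ^ 2 / Real.Gamma ((m : ℝ) / 2) *
        (2 * α ^ 2 * lowerIncompleteGamma (((m : ℝ) + 2) / 2) (1 / (2 * α ^ 2)) +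
          lowerIncompleteGamma ((m : ℝ) / 2) (1 / (2 * α ^ 2)) -
          2 * Real.sqrt 2 * α * lowerIncompleteGamma (((m : ℝ) + 1) / 2) (1 / (2 * α ^ 2))) := by
  have hm0 : (0 : ℝ) < m := by exact_mod_cast hm
  have hx : 0 ≤ 1 / (2 * α ^ 2) := by positivity
  have hsq : ∀ x : Fin m → ℝ, ∑ i, x i ^ 2 = Real.sqrt (∑ i, x i ^ 2) ^ 2 := fun x =>
    (Real.sq_sqrt (Finset.sum_nonneg fun i _ => sq_nonneg (x i))).symm
  have hradial := integral_comp_sqrt_sum_sq_pi_gaussianReal hm fun r =>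
    if r ≤ 1 / α then 4 * α ^ 4 * r ^ 2 - 8 * α ^ 3 * r + 4 * α ^ 2 else 0
  simp only [← hsq] at hradial
  have hterms : ∀ t ∈ Set.Ioi (0 : ℝ),
      t ^ ((m : ℝ) / 2 - 1) * Real.exp (-t) *
        (if Real.sqrt (2 * t) ≤ 1 / α then
          4 * α ^ 4 * Real.sqrt (2 * t) ^ 2 - 8 * α ^ 3 * Real.sqrt (2 * t) + 4 * α ^ 2
        else 0) =
      (Set.Iic (1 / (2 * α ^ 2))).indicator (fun t =>
        8 * α ^ 4 * (t ^ (((m : ℝ) + 2) / 2 - 1) * Real.exp (-t)) +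
          4 * α ^ 2 * (t ^ ((m : ℝ) / 2 - 1) * Real.exp (-t)) -
          8 * Real.sqrt 2 * α ^ 3 * (t ^ (((m : ℝ) + 1) / 2 - 1) * Real.exp (-t))) t := by
    intro t ht
    have ht : 0 < t := ht
    have hiff : Real.sqrt (2 * t) ≤ 1 / α ↔ t ∈ Set.Iic (1 / (2 * α ^ 2)) := by
      rw [Real.sqrt_le_left (by positivity), Set.mem_Iic, div_pow, one_pow,
        le_div_iff₀ (by positivity), le_div_iff₀ (by positivity)]
      ring_nf
    by_cases h : t ∈ Set.Iic (1 / (2 * α ^ 2))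
    · have htwo : t ^ (((m : ℝ) + 2) / 2 - 1) = t ^ ((m : ℝ) / 2 - 1) * t := by
        rw [← Real.rpow_add_one ht.ne']
        congr 1
        ring
      have hone : t ^ (((m : ℝ) + 1) / 2 - 1) = t ^ ((m : ℝ) / 2 - 1) * Real.sqrt t := by
        rw [Real.sqrt_eq_rpow, ← Real.rpow_add ht]
        congr 1
        ring
      rw [if_pos (hiff.mpr h), Set.indicator_of_mem h, htwo, hone, Real.sq_sqrt (by positivity),
        Real.sqrt_mul two_pos.le]
      ring
    · rw [if_neg (mt hiff.mp h), Set.indicator_of_notMem h, mul_zero]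
  have h_integrable : ∀ (a c : ℝ), 0 < a →
      Integrable (fun t : ℝ => c * (t ^ (a - 1) * Real.exp (-t)))
        (volume.restrict (Set.Ioc 0 (1 / (2 * α ^ 2)))) := fun a c ha =>
    (integrableOn_Ioc_rpow_mul_exp_neg ha _).const_mul c
  rw [hradial, setIntegral_congr_fun measurableSet_Ioi hterms,
    setIntegral_indicator measurableSet_Iic, Set.Ioi_inter_Iic,
    integral_sub ((h_integrable _ _ (by positivity)).fun_add (h_integrable _ _ (by positivity)))
      (h_integrable _ _ (by positivity)),
    integral_add (h_integrable _ _ (by positivity)) (h_integrable _ _ (by positivity)),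
    integral_const_mul, integral_const_mul, integral_const_mul]
  simp only [lowerIncompleteGamma, intervalIntegral.integral_of_le hx]
  ring
end

section
/- Define θ(P) for positive integers P by θ(P) = [((P−1)/2)!]²·2^(P−1)/P! when P is odd, and θ(P) = (P−1)!·π / ( (P/2)!·(P/2 − 1)!·2^P ) when P is even. Then: (a) for every P ≥ 1, θ(P+2)²·(P+2) ≥ θ(P)²·P; (b) θ(2)²·2 = π²/8 > 1 = θ(1)²·1; and consequently (c) θ(P)²·P ≥ 1 for every P ≥ 1. -/
/-- The constant `θ(P)` of the BS-LMS analysis: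
`θ(P) = [((P-1)/2)!]² 2^(P-1) / P!` for odd `P` and
`θ(P) = (P-1)! π / ((P/2)! (P/2-1)! 2^P)` for even `P`. -/
noncomputable def theta (P : ℕ) : ℝ :=
  if P % 2 = 1 then
    (((P - 1) / 2).factorial : ℝ) ^ 2 * 2 ^ (P - 1) / (P.factorial : ℝ)
  else
    ((P - 1).factorial : ℝ) * Real.pi /
      (((P / 2).factorial : ℝ) * ((P / 2 - 1).factorial : ℝ) * 2 ^ P)

/-- The two-step recurrence `θ(P+2) = θ(P) (P+1) / (P+2)`. -/
theorem theta_add_two {P : ℕ} (hP : 1 ≤ P) :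
    theta (P + 2) = theta P * ((P + 1) / (P + 2)) := by
  rcases Nat.even_or_odd' P with ⟨m, rfl | rfl⟩
  · obtain ⟨k, rfl⟩ : ∃ k, m = k + 1 := ⟨m - 1, by omega⟩
    have h₁ : (2 * (k + 1) + 2) % 2 ≠ 1 := by omega
    have h₂ : (2 * (k + 1)) % 2 ≠ 1 := by omega
    have e₁ : (2 * (k + 1) + 2) / 2 = k + 2 := by omega
    have e₂ : 2 * (k + 1) / 2 = k + 1 := by omega
    have e₃ : 2 * (k + 1) + 2 - 1 = 2 * k + 1 + 1 + 1 := by omega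
    have e₄ : 2 * (k + 1) - 1 = 2 * k + 1 := by omega
    have e₅ : k + 2 - 1 = k + 1 := by omega
    rw [theta, theta, if_neg h₁, if_neg h₂, e₁, e₂, e₃, e₄, e₅, Nat.add_sub_cancel,
      Nat.factorial_succ (2 * k + 1 + 1), Nat.factorial_succ (2 * k + 1),
      Nat.factorial_succ (k + 1), Nat.factorial_succ k, pow_add]
    push_cast
    field_simp
    ring
  · have h₁ : (2 * m + 1 + 2) % 2 = 1 := by omega
    have h₂ : (2 * m + 1) % 2 = 1 := by omega
    have e₁ : 2 * m + 1 + 2 - 1 = 2 * m + 2 := by omega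
    have e₂ : (2 * m + 2) / 2 = m + 1 := by omega
    have e₃ : 2 * m / 2 = m := by omega
    rw [theta, theta, if_pos h₁, if_pos h₂, e₁, e₂, Nat.add_sub_cancel, e₃,
      Nat.factorial_succ (2 * m + 1 + 1), Nat.factorial_succ (2 * m + 1),
      Nat.factorial_succ m, pow_add]
    push_cast
    field_simp
    ring

theorem theta_one : theta 1 = 1 := by simp [theta]

theorem theta_two : theta 2 = Real.pi / 4 := by norm_num [theta]

theorem theta_sq_mul_le {P : ℕ} (hP : 1 ≤ P) :
    theta P ^ 2 * P ≤ theta (P + 2) ^ 2 * (P + 2) := by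
  have h : (P : ℝ) ≤ ((P + 1) / (P + 2)) ^ 2 * (P + 2) := by
    rw [div_pow, div_mul_eq_mul_div, le_div_iff₀ (by positivity)]
    nlinarith [(Nat.cast_nonneg P : (0 : ℝ) ≤ P)]
  rw [theta_add_two hP, mul_pow, mul_assoc]
  exact mul_le_mul_of_nonneg_left h (sq_nonneg _)

theorem one_lt_pi_sq_div_eight : (1 : ℝ) < Real.pi ^ 2 / 8 := by
  nlinarith [Real.pi_gt_three]

theorem one_le_theta_sq_mul (P : ℕ) (hP : 1 ≤ P) : (1 : ℝ) ≤ theta P ^ 2 * P := by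
  induction P using Nat.twoStepInduction with
  | zero => omega
  | one => simp [theta_one]
  | more n ih _ =>
    rcases Nat.eq_zero_or_pos n with rfl | hn
    · rw [zero_add, theta_two]
      push_cast
      linarith [one_lt_pi_sq_div_eight]
    · push_cast
      exact (ih hn).trans (theta_sq_mul_le hn)

/-- (a) `θ(P+2)² (P+2) ≥ θ(P)² P` for every `P ≥ 1`;
(b) `θ(2)² · 2 = π²/8 > 1 = θ(1)² · 1`; and consequently
(c) `θ(P)² P ≥ 1` for every `P ≥ 1`. -/
theorem stmt_12 :
    (∀ P : ℕ, 1 ≤ P → theta P ^ 2 * P ≤ theta (P + 2) ^ 2 * (P + 2)) ∧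
    (theta 2 ^ 2 * 2 = Real.pi ^ 2 / 8 ∧ (1 : ℝ) < Real.pi ^ 2 / 8 ∧
      theta 1 ^ 2 * 1 = 1) ∧
    (∀ P : ℕ, 1 ≤ P → (1 : ℝ) ≤ theta P ^ 2 * P) := by
  refine ⟨fun P hP => theta_sq_mul_le hP, ⟨?_, one_lt_pi_sq_div_eight, ?_⟩, one_le_theta_sq_mul⟩
  · rw [theta_two]
    ring
  · simp [theta_one]
end
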